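/- arXiv:1908.02457 — 3 statements merged into one kernel-verified Lean document; each statement's English description precedes it below -/
import Mathlib

section
/- The inequality −3J ≤ U(c,n₁,n₂,n₃) holds for all c, n₁, n₂, n₃ ∈ {0,1,2} if and only if J ≥ 0 and α ≥ 0. (That is, the value U₆ = −3J is the minimal possible unit-ball energy exactly on the set A₆ = {(J,α) : J ≥ 0, α ≥ 0}.) -/
/-- Unit-ball energy of the SOS model on the Cayley tree of order 2 with spin values
`{0,1,2}`, coupling `J` and translation-invariant external field `α`: for center spin
`c` and neighbor spins `n₁, n₂, n₃`,
`U(c,n₁,n₂,n₃) = -(J/2)·(|c−n₁| + |c−n₂| + |c−n₃|) + α·c`. -/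
noncomputable def ballEnergy (J α : ℝ) (c n₁ n₂ n₃ : Fin 3) : ℝ :=
  -(J / 2) * (|((c : ℕ) : ℝ) - ((n₁ : ℕ) : ℝ)| + |((c : ℕ) : ℝ) - ((n₂ : ℕ) : ℝ)|
      + |((c : ℕ) : ℝ) - ((n₃ : ℕ) : ℝ)|)
    + α * ((c : ℕ) : ℝ)

theorem abs_fin_three_sub_le_two (a b : Fin 3) : |((a : ℕ) : ℝ) - ((b : ℕ) : ℝ)| ≤ 2 := by
  have ha : ((a : ℕ) : ℝ) ≤ 2 := by exact_mod_cast Nat.le_of_lt_succ a.isLt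
  have hb : ((b : ℕ) : ℝ) ≤ 2 := by exact_mod_cast Nat.le_of_lt_succ b.isLt
  have ha' : (0 : ℝ) ≤ ((a : ℕ) : ℝ) := Nat.cast_nonneg _
  have hb' : (0 : ℝ) ≤ ((b : ℕ) : ℝ) := Nat.cast_nonneg _
  rw [abs_le]
  constructor <;> linarith

/-- `U₆ = −3J` is the minimal unit-ball energy exactly when `J ≥ 0` and `α ≥ 0`. -/
theorem neg_three_J_min_iff (J α : ℝ) :
    (∀ c n₁ n₂ n₃ : Fin 3, -3*J ≤ ballEnergy J α c n₁ n₂ n₃) ↔ (0 ≤ J ∧ 0 ≤ α) := by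
  constructor
  · intro h
    have h₀ := h 0 0 0 0
    have h₂ := h 2 0 0 0
    norm_num [ballEnergy] at h₀ h₂
    constructor <;> linarith
  · rintro ⟨hJ, hα⟩ c n₁ n₂ n₃
    have hsum := add_le_add (add_le_add (abs_fin_three_sub_le_two c n₁)
      (abs_fin_three_sub_le_two c n₂)) (abs_fin_three_sub_le_two c n₃)
    have hmul := mul_le_mul_of_nonneg_left hsum (div_nonneg hJ zero_le_two)
    have hfield : 0 ≤ α * ((c : ℕ) : ℝ) := mul_nonneg hα (Nat.cast_nonneg _)
    unfold ballEnergy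
    linarith
end

section
/- The inequality α ≤ U(c,n₁,n₂,n₃) holds for all c, n₁, n₂, n₃ ∈ {0,1,2} if and only if J ≤ 0 and α = 0. (That is, the value U₁₆ = α is the minimal possible unit-ball energy exactly on the set A₁₆ = {(J,α) : J ≤ 0, α = 0}.) -/
/-- `U₁₆ = α` is the minimal unit-ball energy exactly when `J ≤ 0` and `α = 0`. -/
theorem alpha_min_iff (J α : ℝ) :
    (∀ c n₁ n₂ n₃ : Fin 3, α ≤ ballEnergy J α c n₁ n₂ n₃) ↔ (J ≤ 0 ∧ α = 0) := by
  constructor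
  · intro h
    have h₀ := h 0 0 0 0
    have h₁ := h 0 1 1 1
    have h₂ := h 2 2 2 2
    norm_num [ballEnergy] at h₀ h₁ h₂
    constructor <;> linarith
  · rintro ⟨hJ, rfl⟩ c n₁ n₂ n₃
    rw [ballEnergy, zero_mul, add_zero]
    exact mul_nonneg (by linarith) (by positivity)
end

section
/- The inequality 0 ≤ U(c,n₁,n₂,n₃) holds for all c, n₁, n₂, n₃ ∈ {0,1,2} if and only if J ≤ 0 and α ≥ 0. (That is, the value U₁₈ = 0 is the minimal possible unit-ball energy exactly on the set A₁₈ = {(J,α) : J ≤ 0, α ≥ 0}.) -/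
/-- `U₁₈ = 0` is the minimal unit-ball energy exactly when `J ≤ 0` and `α ≥ 0`. -/
theorem zero_min_iff (J α : ℝ) :
    (∀ c n₁ n₂ n₃ : Fin 3, 0 ≤ ballEnergy J α c n₁ n₂ n₃) ↔ (J ≤ 0 ∧ 0 ≤ α) := by
  constructor
  · intro h
    have hJ := h 0 1 1 1
    have hα := h 1 1 1 1
    norm_num [ballEnergy] at hJ hα
    exact ⟨by linarith, hα⟩
  · rintro ⟨hJ, hα⟩ c n₁ n₂ n₃
    have hJ' : 0 ≤ -(J / 2) := by linarith
    unfold ballEnergy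
    positivity
end
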